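/- arXiv:1811.10094 — 10 statements merged into one kernel-verified Lean document; each statement's English description precedes it below -/
import Mathlib

section
/- The consumer market size x̂(d,a) = (A(d,a) − B(d,a))/(2λ) satisfies the marginal-consumer indifference equation (3): v − x̂(d,a) − t(a+f)/(2r) − d − 1/(μ − λ·x̂(d,a)) = 0. -/
/-- Net valuation of consumer at location 0: K(d,a) = v − d − t(a+f)/(2r). -/
noncomputable def Kf (v r t f d a : ℝ) : ℝ := v - d - t * (a + f) / (2 * r)

/-- A(d,a) = μ + λ·K(d,a). -/
noncomputable def Af (v r t f lam mu d a : ℝ) : ℝ := mu + lam * Kf v r t f d a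

/-- B(d,a) = √((μ − λK(d,a))² + 4λ). -/
noncomputable def Bf (v r t f lam mu d a : ℝ) : ℝ :=
  Real.sqrt ((mu - lam * Kf v r t f d a) ^ 2 + 4 * lam)

/-- Consumer market size x̂(d,a) = (A(d,a) − B(d,a))/(2λ). -/
noncomputable def xhat (v r t f lam mu d a : ℝ) : ℝ :=
  (Af v r t f lam mu d a - Bf v r t f lam mu d a) / (2 * lam)

/-- Number of content providers n(d,a) = r·x̂(d,a)/(a+f). -/
noncomputable def nCP (v r t f lam mu d a : ℝ) : ℝ :=
  r * xhat v r t f lam mu d a / (a + f)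

/-- x̂(d,a) satisfies the marginal-consumer indifference equation. -/
theorem indifference_equation (v r t f lam mu d a : ℝ)
    (hr : 0 < r) (ht0 : 0 < t) (ht1 : t < 1) (hf : 0 < f)
    (hlam : 0 < lam) (hmu : 0 < mu) (hd : 0 ≤ d) (ha : 0 ≤ a) :
    v - xhat v r t f lam mu d a - t * (a + f) / (2 * r) - d
      - 1 / (mu - lam * xhat v r t f lam mu d a) = 0 := by
  have hB : Bf v r t f lam mu d a ^ 2 = (mu - lam * Kf v r t f d a) ^ 2 + 4 * lam :=
    Real.sq_sqrt (by positivity)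
  have hB0 : 0 ≤ Bf v r t f lam mu d a := Real.sqrt_nonneg _
  have hx : 2 * lam * xhat v r t f lam mu d a
      = mu + lam * Kf v r t f d a - Bf v r t f lam mu d a := by
    unfold xhat Af
    field_simp
  have hK : v - xhat v r t f lam mu d a - t * (a + f) / (2 * r) - d
      = Kf v r t f d a - xhat v r t f lam mu d a := by
    unfold Kf; ring
  rw [hK]
  generalize xhat v r t f lam mu d a = x at *
  generalize Kf v r t f d a = K at *
  generalize Bf v r t f lam mu d a = B at *
  have hBm : |mu - lam * K| < B := abs_lt_of_sq_lt_sq (by linarith) hB0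
  have hD : 0 < mu - lam * x := by
    have := (abs_lt.mp hBm).1
    linarith
  have hp : (K - x) * (mu - lam * x) = 1 := by
    have hBe : B = mu + lam * K - 2 * lam * x := by linarith
    subst hBe
    have : lam * ((K - x) * (mu - lam * x)) = lam * 1 := by linarith
    exact mul_left_cancel₀ hlam.ne' this
  rw [sub_eq_zero, eq_div_iff hD.ne']
  exact hp
end

section
/- The consumer market size is strictly positive if and only if the net surplus of the consumer at location 0 is positive: x̂(d,a) > 0 if and only if K(d,a) > 1/μ. -/
/-- x̂(d,a) > 0 iff K(d,a) > 1/μ. -/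
theorem positive_market_iff (v r t f lam mu d a : ℝ)
    (hr : 0 < r) (ht0 : 0 < t) (ht1 : t < 1) (hf : 0 < f)
    (hlam : 0 < lam) (hmu : 0 < mu) (hd : 0 ≤ d) (ha : 0 ≤ a) :
    0 < xhat v r t f lam mu d a ↔ 1 / mu < Kf v r t f d a := by
  have key : 0 < xhat v r t f lam mu d a ↔
      Bf v r t f lam mu d a < Af v r t f lam mu d a := by
    unfold xhat
    rw [div_pos_iff_of_pos_right (by positivity), sub_pos]
  rw [key, div_lt_iff₀ hmu]
  unfold Bf Af
  generalize Kf v r t f d a = K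
  constructor
  · intro h
    have hpos : 0 < mu + lam * K := lt_of_le_of_lt (Real.sqrt_nonneg _) h
    rw [Real.sqrt_lt' hpos] at h
    have h2 : 0 < lam * (K * mu - 1) := by nlinarith
    have := (mul_pos_iff_of_pos_left hlam).1 h2
    linarith
  · intro h
    have hK : 0 < K := by
      by_contra hc
      nlinarith
    have hpos : 0 < mu + lam * K := by positivity
    rw [Real.sqrt_lt' hpos]
    have h2 : 0 < lam * (K * mu - 1) := mul_pos hlam (by linarith)
    nlinarith
end

section
/- The consumer market size is strictly decreasing in the consumer access price: if 0 ≤ d₁ < d₂, then x̂(d₁,a) > x̂(d₂,a). -/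
theorem sqrt_aux (c x y : ℝ) (hc : 0 < c) (h : x < y) :
    x + Real.sqrt (x ^ 2 + c) < y + Real.sqrt (y ^ 2 + c) := by
  have hs : -y < Real.sqrt (y ^ 2 + c) := by
    apply Real.lt_sqrt_of_sq_lt
    nlinarith
  have h0 := Real.sqrt_nonneg (y ^ 2 + c)
  have hq : Real.sqrt (y ^ 2 + c) ^ 2 = y ^ 2 + c := Real.sq_sqrt (by positivity)
  have : Real.sqrt (x ^ 2 + c) < Real.sqrt (y ^ 2 + c) + (y - x) := by
    rw [Real.sqrt_lt' (by linarith)]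
    nlinarith [mul_pos (sub_pos.2 h) (show 0 < Real.sqrt (y ^ 2 + c) + y by linarith)]
  linarith

/-- the consumer market size is strictly decreasing in the consumer access price. -/
theorem xhat_strict_anti_in_d (v r t f lam mu a d₁ d₂ : ℝ)
    (hr : 0 < r) (ht0 : 0 < t) (ht1 : t < 1) (hf : 0 < f)
    (hlam : 0 < lam) (hmu : 0 < mu) (ha : 0 ≤ a)
    (hd1 : 0 ≤ d₁) (hd12 : d₁ < d₂) :
    xhat v r t f lam mu d₂ a < xhat v r t f lam mu d₁ a := by
  have hK : mu - lam * Kf v r t f d₁ a < mu - lam * Kf v r t f d₂ a := by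
    unfold Kf
    nlinarith [mul_pos hlam (sub_pos.2 hd12)]
  have key := sqrt_aux (4 * lam) _ _ (by positivity) hK
  unfold xhat
  apply div_lt_div_of_pos_right _ (by positivity)
  unfold Af Bf
  linarith
end

section
/- The consumer market size is strictly decreasing in the provider access price: if 0 ≤ a₁ < a₂, then x̂(d,a₁) > x̂(d,a₂). -/
/-- the consumer market size is strictly decreasing in the provider access price. -/
theorem xhat_strict_anti_in_a (v r t f lam mu d a₁ a₂ : ℝ)
    (hr : 0 < r) (ht0 : 0 < t) (ht1 : t < 1) (hf : 0 < f)
    (hlam : 0 < lam) (hmu : 0 < mu) (hd : 0 ≤ d)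
    (ha1 : 0 ≤ a₁) (ha12 : a₁ < a₂) :
    xhat v r t f lam mu d a₂ < xhat v r t f lam mu d a₁ := by
  have hK : Kf v r t f d a₂ < Kf v r t f d a₁ := by
    unfold Kf
    have : t * (a₁ + f) / (2 * r) < t * (a₂ + f) / (2 * r) := by gcongr
    linarith
  have hp := mul_lt_mul_of_pos_left hK hlam
  unfold xhat Af Bf
  generalize lam * Kf v r t f d a₂ = p at *
  generalize lam * Kf v r t f d a₁ = q at *
  apply div_lt_div_of_pos_right _ (by positivity : (0:ℝ) < 2 * lam)
  have h0 := Real.sqrt_nonneg ((mu - p) ^ 2 + 4 * lam)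
  have hs := Real.sq_sqrt (by positivity : (0:ℝ) ≤ (mu - p) ^ 2 + 4 * lam)
  have hB : -(mu - p) < Real.sqrt ((mu - p) ^ 2 + 4 * lam) := by
    apply Real.lt_sqrt_of_sq_lt
    nlinarith
  have : Real.sqrt ((mu - q) ^ 2 + 4 * lam) < Real.sqrt ((mu - p) ^ 2 + 4 * lam) + (q - p) := by
    rw [Real.sqrt_lt' (by linarith)]
    nlinarith [mul_pos (sub_pos.2 hp) (sub_pos.2 hB)]
  linarith
end

section
/- Assume x̂(d,a) > 0 and d > 0. Then the elasticity of consumer demand with respect to the consumer access price satisfies e(x̂(d,a), d) := −d·(∂x̂/∂d)/x̂(d,a) = λd·(μ − λK(d,a) + B(d,a)) / (B(d,a)·(A(d,a) − B(d,a))). -/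
/-- elasticity of consumer demand with respect to the consumer access price. -/
theorem elasticity_xhat_d (v r t f lam mu d a : ℝ)
    (hr : 0 < r) (ht0 : 0 < t) (ht1 : t < 1) (hf : 0 < f)
    (hlam : 0 < lam) (hmu : 0 < mu) (ha : 0 ≤ a)
    (hx : 0 < xhat v r t f lam mu d a) (hd : 0 < d) :
    -d * deriv (fun d' => xhat v r t f lam mu d' a) d / xhat v r t f lam mu d a
      = lam * d * (mu - lam * Kf v r t f d a + Bf v r t f lam mu d a)
        / (Bf v r t f lam mu d a * (Af v r t f lam mu d a - Bf v r t f lam mu d a)) := by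
  have hK : HasDerivAt (fun d' => Kf v r t f d' a) (-1) d := by
    unfold Kf
    simpa using ((hasDerivAt_id d).const_sub v).sub_const (t * (a + f) / (2 * r))
  have hpos : 0 < (mu - lam * Kf v r t f d a) ^ 2 + 4 * lam := by positivity
  have hBpos : 0 < Bf v r t f lam mu d a := Real.sqrt_pos.mpr hpos
  have hA : HasDerivAt (fun d' => Af v r t f lam mu d' a) (lam * (-1)) d :=
    (hK.const_mul lam).const_add mu
  have hB : HasDerivAt (fun d' => Bf v r t f lam mu d' a)
      (2 * (mu - lam * Kf v r t f d a) * lam / (2 * Bf v r t f lam mu d a)) d := by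
    have h1 := ((((hK.const_mul lam).const_sub mu).pow 2).add_const (4 * lam)).sqrt hpos.ne'
    convert h1 using 1
    all_goals simp [Bf]
  have hX : HasDerivAt (fun d' => xhat v r t f lam mu d' a) _ d :=
    (hA.sub hB).div_const (2 * lam)
  rw [hX.deriv]
  have hAB : 0 < Af v r t f lam mu d a - Bf v r t f lam mu d a := by
    have h2 : (0:ℝ) < 2 * lam := by positivity
    unfold xhat at hx
    exact (div_pos_iff_of_pos_right h2).mp hx
  unfold xhat
  generalize Bf v r t f lam mu d a = B at *
  generalize Af v r t f lam mu d a = A at *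
  have := hAB.ne'
  have := hBpos.ne'
  field_simp
  ring
end

section
/- Assume x̂(d,a) > 0 and a > 0. Then the elasticity of consumer demand with respect to the provider access price satisfies e(x̂(d,a), a) := −a·(∂x̂/∂a)/x̂(d,a) = λta·(μ − λK(d,a) + B(d,a)) / (2r·B(d,a)·(A(d,a) − B(d,a))). -/
/-- elasticity of consumer demand with respect to the provider access price. -/
theorem elasticity_xhat_a (v r t f lam mu d a : ℝ)
    (hr : 0 < r) (ht0 : 0 < t) (ht1 : t < 1) (hf : 0 < f)
    (hlam : 0 < lam) (hmu : 0 < mu) (hd : 0 ≤ d)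
    (hx : 0 < xhat v r t f lam mu d a) (ha : 0 < a) :
    -a * deriv (fun a' => xhat v r t f lam mu d a') a / xhat v r t f lam mu d a
      = lam * t * a * (mu - lam * Kf v r t f d a + Bf v r t f lam mu d a)
        / (2 * r * Bf v r t f lam mu d a
            * (Af v r t f lam mu d a - Bf v r t f lam mu d a)) := by
  have hK : HasDerivAt (fun a' => Kf v r t f d a') (-(t / (2 * r))) a := by
    unfold Kf
    have h := ((((hasDerivAt_id a).add_const f).const_mul t).div_const (2 * r)).const_sub (v - d)
    simpa using h
  have hpos : 0 < (mu - lam * Kf v r t f d a) ^ 2 + 4 * lam := by positivity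
  have hA : HasDerivAt (fun a' => Af v r t f lam mu d a') (lam * (-(t / (2 * r)))) a :=
    (hK.const_mul lam).const_add mu
  have hB := ((((hK.const_mul lam).const_sub mu).pow 2).add_const (4 * lam)).sqrt hpos.ne'
  have hX := ((hA.sub hB).div_const (2 * lam)).deriv
  have hBpos : 0 < Bf v r t f lam mu d a := Real.sqrt_pos.mpr hpos
  have hAB : 0 < Af v r t f lam mu d a - Bf v r t f lam mu d a := by
    unfold xhat at hx
    exact (div_pos_iff_of_pos_right (by positivity)).mp hx
  have hX' : deriv (fun a' => xhat v r t f lam mu d a') a =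
      -(t / (4 * r)) * (mu - lam * Kf v r t f d a + Bf v r t f lam mu d a)
        / Bf v r t f lam mu d a := by
    refine Eq.trans hX ?_
    change (_ - _ / (2 * Bf v r t f lam mu d a)) / _ = _
    push_cast
    field_simp
    ring
  rw [hX']
  unfold xhat
  generalize Af v r t f lam mu d a - Bf v r t f lam mu d a = D at *
  field_simp
  try ring
end

section
/- Assume x̂(d,a) > 0, d > 0 and a > 0. Then the ISP's first-order condition in the consumer price, e(x̂(d,a), d) + (a·n(d,a)/(d·x̂(d,a)))·e(n(d,a), d) = 1, holds if and only if e(x̂(d,a), d) = (da + df)/(da + df + ra). -/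
/-- the ISP's first-order condition in the consumer price holds iff
e(x̂,d) = (da + df)/(da + df + ra). -/
theorem FOC_d_iff (v r t f lam mu d a : ℝ)
    (hr : 0 < r) (ht0 : 0 < t) (ht1 : t < 1) (hf : 0 < f)
    (hlam : 0 < lam) (hmu : 0 < mu)
    (hx : 0 < xhat v r t f lam mu d a) (hd : 0 < d) (ha : 0 < a) :
    (-d * deriv (fun d' => xhat v r t f lam mu d' a) d / xhat v r t f lam mu d a
        + (a * nCP v r t f lam mu d a / (d * xhat v r t f lam mu d a))
          * (-d * deriv (fun d' => nCP v r t f lam mu d' a) d / nCP v r t f lam mu d a)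
      = 1)
    ↔ -d * deriv (fun d' => xhat v r t f lam mu d' a) d / xhat v r t f lam mu d a
        = (d * a + d * f) / (d * a + d * f + r * a) := by
  have hn : deriv (fun d' => nCP v r t f lam mu d' a) d
      = r * deriv (fun d' => xhat v r t f lam mu d' a) d / (a + f) := by
    simp only [nCP]
    rw [deriv_div_const, deriv_const_mul_field]
  rw [hn]
  simp only [nCP]
  generalize deriv (fun d' => xhat v r t f lam mu d' a) d = D
  generalize xhat v r t f lam mu d a = X at hx
  have haf : 0 < a + f := by positivity
  have hS : 0 < d * a + d * f + r * a := by positivity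
  have h2 : (a * (r * X / (a + f)) / (d * X)) * (-d * (r * D / (a + f)) / (r * X / (a + f)))
      = (a * r / (d * (a + f))) * (-d * D / X) := by
    field_simp
  rw [h2]
  generalize -d * D / X = e
  have h3 : e + a * r / (d * (a + f)) * e = e * (d * a + d * f + r * a) / (d * a + d * f) := by
    have : d * a + d * f = d * (a + f) := by ring
    rw [this]
    field_simp
  have hT : 0 < d * a + d * f := by positivity
  rw [h3, div_eq_iff hT.ne', eq_div_iff hS.ne', one_mul]
end

section
/- The consumer market size shrinks as congestion increases: fix v, r, t, f, μ > 0, d ≥ 0, a ≥ 0 and let x̂_λ = (μ + λK − √((μ − λK)² + 4λ))/(2λ) with K = v − d − t(a+f)/(2r). If 0 < λ₁ < λ₂ < μ and x̂_{λ₂} > 0, then x̂_{λ₁} > x̂_{λ₂}. -/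
/-- the consumer market size shrinks as congestion (the request rate λ)
increases. -/
theorem xhat_anti_in_lambda (v r t f mu d a lam₁ lam₂ : ℝ)
    (hr : 0 < r) (ht0 : 0 < t) (ht1 : t < 1) (hf : 0 < f)
    (hmu : 0 < mu) (hd : 0 ≤ d) (ha : 0 ≤ a)
    (hl1 : 0 < lam₁) (hl12 : lam₁ < lam₂) (hl2m : lam₂ < mu)
    (hx2 : 0 < xhat v r t f lam₂ mu d a) :
    xhat v r t f lam₂ mu d a < xhat v r t f lam₁ mu d a := by
  set x := xhat v r t f lam₂ mu d a with hx
  have hl2 : 0 < lam₂ := hl1.trans hl12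
  have hB : Bf v r t f lam₂ mu d a = Af v r t f lam₂ mu d a - 2 * lam₂ * x := by
    rw [hx]; unfold xhat; field_simp; ring
  unfold xhat
  rw [lt_div_iff₀ (by positivity)]
  unfold Af Bf at *
  generalize Kf v r t f d a = K at *
  have hBp : 0 < √((mu - lam₂ * K) ^ 2 + 4 * lam₂) := Real.sqrt_pos.mpr (by positivity)
  have hsq : √((mu - lam₂ * K) ^ 2 + 4 * lam₂) ^ 2 = (mu - lam₂ * K) ^ 2 + 4 * lam₂ :=
    Real.sq_sqrt (by positivity)
  rw [hB] at hBp hsq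
  have hpq : (mu - lam₂ * x) * (K - x) = 1 := by
    have h : lam₂ * ((mu - lam₂ * x) * (K - x)) = lam₂ * 1 := by linarith
    exact mul_left_cancel₀ hl2.ne' h
  have hq : 0 < K - x := by
    by_contra hn
    have hp : 0 < mu - lam₂ * x := by nlinarith
    nlinarith
  have hlt : lam₁ * x < lam₂ * x := mul_lt_mul_of_pos_right hl12 hx2
  have hp : 0 < mu - lam₂ * x := by
    by_contra hn
    nlinarith
  have h1 : 1 < (mu - lam₁ * x) * (K - x) := by nlinarith
  have h2 : 0 < lam₁ * ((mu - lam₁ * x) * (K - x) - 1) := mul_pos hl1 (by linarith)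
  have h3 : 0 < lam₁ * (K - x) := mul_pos hl1 hq
  have : √((mu - lam₁ * K) ^ 2 + 4 * lam₁) < mu + lam₁ * K - 2 * lam₁ * x := by
    rw [Real.sqrt_lt' (by linarith)]
    linarith
  linarith
end

section
/- The number of content providers is strictly decreasing in the provider access price: if 0 ≤ a₁ < a₂ and x̂(d,a₂) > 0, then n(d,a₁) = r·x̂(d,a₁)/(a₁+f) > r·x̂(d,a₂)/(a₂+f) = n(d,a₂). -/
/-- the number of content providers is strictly decreasing in the
provider access price. -/
theorem nCP_strict_anti_in_a (v r t f lam mu d a₁ a₂ : ℝ)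
    (hr : 0 < r) (ht0 : 0 < t) (ht1 : t < 1) (hf : 0 < f)
    (hlam : 0 < lam) (hmu : 0 < mu) (hd : 0 ≤ d)
    (ha1 : 0 ≤ a₁) (ha12 : a₁ < a₂)
    (hx2 : 0 < xhat v r t f lam mu d a₂) :
    nCP v r t f lam mu d a₂ < nCP v r t f lam mu d a₁ := by
  have haf1 : 0 < a₁ + f := by linarith
  have haf : a₁ + f < a₂ + f := by linarith
  have hK : Kf v r t f d a₂ ≤ Kf v r t f d a₁ := by
    unfold Kf
    have : t * (a₁ + f) / (2 * r) ≤ t * (a₂ + f) / (2 * r) := by gcongr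
    linarith
  have hx : xhat v r t f lam mu d a₂ ≤ xhat v r t f lam mu d a₁ := by
    unfold xhat Af Bf
    generalize Kf v r t f d a₂ = k2 at *
    generalize Kf v r t f d a₁ = k1 at *
    have hδ : 0 ≤ lam * (k1 - k2) := mul_nonneg hlam.le (by linarith)
    have h0 := Real.sqrt_nonneg ((mu - lam * k2) ^ 2 + 4 * lam)
    have hs := Real.sq_sqrt (show 0 ≤ (mu - lam * k2) ^ 2 + 4 * lam by positivity)
    have hu : -(mu - lam * k2) ≤ √((mu - lam * k2) ^ 2 + 4 * lam) := by
      apply Real.le_sqrt_of_sq_le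
      nlinarith
    have hB : √((mu - lam * k1) ^ 2 + 4 * lam)
        ≤ √((mu - lam * k2) ^ 2 + 4 * lam) + lam * (k1 - k2) := by
      rw [Real.sqrt_le_iff]
      refine ⟨by linarith, ?_⟩
      have := mul_le_mul_of_nonneg_right hu hδ
      nlinarith
    apply div_le_div_of_nonneg_right _ (by positivity)
    linarith
  unfold nCP
  calc r * xhat v r t f lam mu d a₂ / (a₂ + f)
      < r * xhat v r t f lam mu d a₂ / (a₁ + f) :=
        div_lt_div_of_pos_left (mul_pos hr hx2) haf1 haf
    _ ≤ r * xhat v r t f lam mu d a₁ / (a₁ + f) := by gcongr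
end

section
/- The number of content providers is strictly decreasing in the consumer access price: if 0 ≤ d₁ < d₂ and x̂(d₂,a) > 0... then n(d₁,a) = r·x̂(d₁,a)/(a+f) > r·x̂(d₂,a)/(a+f) = n(d₂,a); moreover the zero-profit condition holds: each of the n(d,a) providers, facing demand x̂(d,a)/n(d,a), earns profit r·x̂(d,a)/n(d,a) − f − a = 0 whenever x̂(d,a) > 0. -/
/-- the number of content providers is strictly decreasing in the
consumer access price; moreover, the zero-profit condition holds for each provider. -/
theorem nCP_anti_in_d_and_zero_profit (v r t f lam mu a d₁ d₂ : ℝ)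
    (hr : 0 < r) (ht0 : 0 < t) (ht1 : t < 1) (hf : 0 < f)
    (hlam : 0 < lam) (hmu : 0 < mu) (ha : 0 ≤ a)
    (hd1 : 0 ≤ d₁) (hd12 : d₁ < d₂)
    (hx2 : 0 < xhat v r t f lam mu d₂ a) :
    nCP v r t f lam mu d₂ a < nCP v r t f lam mu d₁ a
    ∧ ∀ d : ℝ, 0 ≤ d → 0 < xhat v r t f lam mu d a →
        r * (xhat v r t f lam mu d a / nCP v r t f lam mu d a) - f - a = 0 := by
  have haf : 0 < a + f := by linarith
  refine ⟨?_, ?_⟩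
  · have key : xhat v r t f lam mu d₂ a < xhat v r t f lam mu d₁ a := by
      unfold xhat
      apply div_lt_div_of_pos_right _ (by positivity)
      have hK : Kf v r t f d₁ a = Kf v r t f d₂ a + (d₂ - d₁) := by
        unfold Kf; ring
      unfold Af Bf
      rw [hK]
      generalize Kf v r t f d₂ a = k
      have hδ : 0 < lam * (d₂ - d₁) := mul_pos hlam (by linarith)
      have hB : -(mu - lam * k) < √((mu - lam * k) ^ 2 + 4 * lam) := by
        apply Real.lt_sqrt_of_sq_lt
        nlinarith
      have hsq : √((mu - lam * k) ^ 2 + 4 * lam) ^ 2 = (mu - lam * k) ^ 2 + 4 * lam :=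
        Real.sq_sqrt (by positivity)
      have h0 := Real.sqrt_nonneg ((mu - lam * k) ^ 2 + 4 * lam)
      have hlt : √((mu - lam * (k + (d₂ - d₁))) ^ 2 + 4 * lam)
          < √((mu - lam * k) ^ 2 + 4 * lam) + lam * (d₂ - d₁) := by
        rw [Real.sqrt_lt' (by linarith)]
        have := mul_pos hδ (sub_pos.mpr hB)
        nlinarith
      linarith
    unfold nCP
    exact div_lt_div_of_pos_right (mul_lt_mul_of_pos_left key hr) haf
  · intro d _ hx
    unfold nCP
    have := hx.ne'
    have := haf.ne'
    have := hr.ne'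
    field_simp
    ring
end
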